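/- The Hanoi Towers group H(3) is regularly branching over its commutator subgroup K = [H(3), H(3)]: letting ψ : Sym(X*)³ → Sym(X*) be the map sending (k₀, k₁, k₂) to the permutation fixing the empty word and sending x·w ↦ x·k_x(w) for x ∈ {0,1,2} and w ∈ X*, the image ψ(K × K × K) is contained in K, is a normal subgroup of H(3), and has finite index in H(3). -/

import Mathlib

/-- The generator `a_{(ij)}` of the Hanoi Towers group, acting on finite words:
`a_{(ij)}(iw) = jw`, `a_{(ij)}(jw) = iw`, `a_{(ij)}(xw) = x · a_{(ij)}(w)` for `x ∉ {i,j}`,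
and `a_{(ij)}(ε) = ε`. -/
def hMove {k : ℕ} (i j : Fin k) : List (Fin k) → List (Fin k)
  | [] => []
  | x :: w => if x = i then j :: w else if x = j then i :: w else x :: hMove i j w

theorem hMove_involutive {k : ℕ} (i j : Fin k) : ∀ l, hMove i j (hMove i j l) = l := by
  intro l
  induction l with
  | nil => rfl
  | cons x w ih =>
    by_cases hxi : x = i
    · by_cases hij : j = i <;> simp [hMove, hxi, hij]
    · by_cases hxj : x = j
      · by_cases hij : j = i <;> simp [hMove, hxi, hxj, hij]
      · simp [hMove, hxi, hxj, ih]

/-- The generator `a_{(ij)}` as a permutation of the set of finite words. -/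
def hGen {k : ℕ} (i j : Fin k) : Equiv.Perm (List (Fin k)) :=
  ⟨hMove i j, hMove i j, hMove_involutive i j, hMove_involutive i j⟩

/-- The Hanoi Towers group `H(k)`, the subgroup of the permutation group of the set of
finite words over `{0, …, k-1}` generated by the `a_{(ij)}` for `i < j`. -/
def HanoiGroup (k : ℕ) : Subgroup (Equiv.Perm (List (Fin k))) :=
  Subgroup.closure {g | ∃ i j : Fin k, i < j ∧ g = hGen i j}

theorem hMove_length {k : ℕ} (i j : Fin k) (l : List (Fin k)) :
    (hMove i j l).length = l.length := by
  induction l with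
  | nil => rfl
  | cons x w ih =>
    by_cases hxi : x = i
    · by_cases hij : j = i <;> simp [hMove, hxi, hij]
    · by_cases hxj : x = j
      · by_cases hij : j = i <;> simp [hMove, hxi, hxj, hij]
      · simp [hMove, hxi, hxj, ih]

/-- The underlying function of `ψ(k₀,k₁,k₂)`: it fixes the empty word and sends
`x·w ↦ x·k_x(w)`. -/
def psiFun (k₀ k₁ k₂ : Equiv.Perm (List (Fin 3))) : List (Fin 3) → List (Fin 3)
  | [] => []
  | x :: w => x :: (![k₀, k₁, k₂] x) w

/-- The map `ψ : Sym(X*)³ → Sym(X*)` sending `(k₀,k₁,k₂)` to the permutation fixing the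
empty word and sending `x·w ↦ x·k_x(w)` for `x ∈ {0,1,2}`. -/
def psi (k₀ k₁ k₂ : Equiv.Perm (List (Fin 3))) : Equiv.Perm (List (Fin 3)) where
  toFun := psiFun k₀ k₁ k₂
  invFun := psiFun k₀⁻¹ k₁⁻¹ k₂⁻¹
  left_inv := by
    intro w
    cases w with
    | nil => rfl
    | cons x w => fin_cases x <;> simp [psiFun]
  right_inv := by
    intro w
    cases w with
    | nil => rfl
    | cons x w => fin_cases x <;> simp [psiFun]

open scoped commutatorElement

/-- If `S` generates `G`, a subgroup normalised by `G` and containing the commutators of elements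
of `S` contains `⁅G, G⁆`. -/
theorem commutator_closure_le {G : Type*} [Group G] {S : Set G} {N : Subgroup G}
    (hconj : ∀ g ∈ Subgroup.closure S, ∀ n ∈ N, g * n * g⁻¹ ∈ N)
    (hS : ∀ x ∈ S, ∀ y ∈ S, ⁅x, y⁆ ∈ N) :
    ⁅Subgroup.closure S, Subgroup.closure S⁆ ≤ N := by
  have swap : ∀ x y : G, ⁅x, y⁆ ∈ N → ⁅y, x⁆ ∈ N := fun x y h => by
    rw [← commutatorElement_inv]; exact N.inv_mem h
  have step : ∀ y, (∀ x ∈ S, ⁅x, y⁆ ∈ N) → ∀ x ∈ Subgroup.closure S, ⁅x, y⁆ ∈ N := by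
    intro y hy x hx
    induction hx using Subgroup.closure_induction with
    | mem x hx => exact hy x hx
    | one => simp
    | mul u v hu hv ihu ihv =>
      have : ⁅u * v, y⁆ = u * ⁅v, y⁆ * u⁻¹ * ⁅u, y⁆ := by
        simp only [commutatorElement_def]; group
      rw [this]
      exact N.mul_mem (hconj u hu _ ihv) ihu
    | inv u hu ihu =>
      have : ⁅u⁻¹, y⁆ = u⁻¹ * ⁅u, y⁆⁻¹ * u⁻¹⁻¹ := by
        simp only [commutatorElement_def]; group
      rw [this]
      exact hconj _ (inv_mem hu) _ (N.inv_mem ihu)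
  rw [Subgroup.commutator_le]
  intro x hx y hy
  exact step y (fun s hs => swap y s (step s (fun t ht => hS t ht s hs) y hy)) x hx

theorem hGen_inv {k : ℕ} (i j : Fin k) : (hGen i j)⁻¹ = hGen i j := rfl

theorem hGen_mul_self {k : ℕ} (i j : Fin k) : hGen i j * hGen i j = 1 :=
  Equiv.ext (hMove_involutive i j)

theorem hGen_mem {k : ℕ} {i j : Fin k} (h : i < j) : hGen i j ∈ HanoiGroup k :=
  Subgroup.subset_closure ⟨i, j, h, rfl⟩

theorem hGen_apply_cons {k : ℕ} (i j x : Fin k) (w : List (Fin k)) :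
    hGen i j (x :: w) =
      if x = i then j :: w else if x = j then i :: w else x :: hGen i j w := rfl

theorem hGen_apply_apply {k : ℕ} (i j : Fin k) (w : List (Fin k)) :
    hGen i j (hGen i j w) = w := hMove_involutive i j w

theorem hanoiGroup_three_eq_closure :
    HanoiGroup 3 = Subgroup.closure {hGen 0 1, hGen 0 2, hGen 1 2} := by
  unfold HanoiGroup
  congr 1
  ext g
  constructor
  · rintro ⟨i, j, hij, rfl⟩
    fin_cases i <;> fin_cases j <;> simp_all
  · rintro (rfl | rfl | rfl)
    exacts [⟨0, 1, by decide, rfl⟩, ⟨0, 2, by decide, rfl⟩, ⟨1, 2, by decide, rfl⟩]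

theorem conj_mem_of_generators {N : Subgroup (Equiv.Perm (List (Fin 3)))}
    (hgen : ∀ g ∈ ({hGen 0 1, hGen 0 2, hGen 1 2} : Set (Equiv.Perm (List (Fin 3)))),
      ∀ n ∈ N, g * n * g⁻¹ ∈ N) :
    ∀ g ∈ HanoiGroup 3, ∀ n ∈ N, g * n * g⁻¹ ∈ N := by
  intro g hg
  rw [hanoiGroup_three_eq_closure] at hg
  induction hg using Subgroup.closure_induction'' with
  | mem x hx => exact hgen x hx
  | inv_mem x hx =>
    have hxx : x⁻¹ = x := by rcases hx with rfl | rfl | rfl <;> rfl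
    rw [hxx]
    exact hgen x hx
  | one => simp
  | mul x y _ _ ihx ihy =>
    intro n hn
    simpa [mul_assoc] using ihx _ (ihy n hn)

section psi

variable (p q r p' q' r' : Equiv.Perm (List (Fin 3)))

theorem psi_apply_nil : psi p q r [] = [] := rfl

theorem psi_apply_cons (x : Fin 3) (w : List (Fin 3)) :
    psi p q r (x :: w) = x :: (![p, q, r] x) w := rfl

theorem psi_mul : psi p q r * psi p' q' r' = psi (p * p') (q * q') (r * r') := by
  ext1 l
  rcases l with _ | ⟨x, w⟩
  · rfl
  · fin_cases x <;> rfl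

theorem psi_one : psi 1 1 1 = 1 := by
  ext1 l
  rcases l with _ | ⟨x, w⟩
  · rfl
  · fin_cases x <;> rfl

theorem hGen_zero_one_conj_psi :
    hGen 0 1 * psi p q r * (hGen 0 1)⁻¹ = psi q p (hGen 0 1 * r * (hGen 0 1)⁻¹) := by
  ext1 l
  rcases l with _ | ⟨x, w⟩
  · rfl
  · fin_cases x <;> rfl

theorem hGen_zero_two_conj_psi :
    hGen 0 2 * psi p q r * (hGen 0 2)⁻¹ = psi r (hGen 0 2 * q * (hGen 0 2)⁻¹) p := by
  ext1 l
  rcases l with _ | ⟨x, w⟩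
  · rfl
  · fin_cases x <;> rfl

theorem hGen_one_two_conj_psi :
    hGen 1 2 * psi p q r * (hGen 1 2)⁻¹ = psi (hGen 1 2 * p * (hGen 1 2)⁻¹) r q := by
  ext1 l
  rcases l with _ | ⟨x, w⟩
  · rfl
  · fin_cases x <;> rfl

end psi

/-- `ψ` as a homomorphism on the triple product. -/
def psiHom : Equiv.Perm (List (Fin 3)) × Equiv.Perm (List (Fin 3)) × Equiv.Perm (List (Fin 3)) →*
    Equiv.Perm (List (Fin 3)) where
  toFun k := psi k.1 k.2.1 k.2.2
  map_one' := psi_one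
  map_mul' _ _ := (psi_mul _ _ _ _ _ _).symm

theorem psi_commutator_zero_one : psi ⁅hGen (0 : Fin 3) 2, hGen (0 : Fin 3) 1⁆ 1 1 =
    ⁅hGen (0 : Fin 3) 1 * hGen 0 2 * hGen 1 2, hGen (0 : Fin 3) 1⁆ * ⁅hGen (1 : Fin 3) 2, hGen (0 : Fin 3) 1⁆ := by
  ext1 l
  rcases l with _ | ⟨x, w⟩
  · rfl
  · fin_cases x <;>
      simp [commutatorElement_def, hGen_inv, hGen_apply_cons, psi_apply_cons, hGen_apply_apply]

theorem psi_commutator_zero_one_one_two : psi ⁅hGen (0 : Fin 3) 1, hGen (1 : Fin 3) 2⁆ 1 1 =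
    ⁅hGen (0 : Fin 3) 2 * hGen 0 1 * hGen 0 2, hGen (1 : Fin 3) 2⁆ := by
  ext1 l
  rcases l with _ | ⟨x, w⟩
  · rfl
  · fin_cases x <;>
      simp [commutatorElement_def, hGen_inv, hGen_apply_cons, psi_apply_cons, hGen_apply_apply]

theorem psi_commutator_zero_two_one_two : psi ⁅hGen (0 : Fin 3) 2, hGen (1 : Fin 3) 2⁆ 1 1 =
    ⁅hGen (0 : Fin 3) 1 * hGen 0 2 * hGen 0 1, hGen (1 : Fin 3) 2⁆ := by
  ext1 l
  rcases l with _ | ⟨x, w⟩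
  · rfl
  · fin_cases x <;>
      simp [commutatorElement_def, hGen_inv, hGen_apply_cons, psi_apply_cons, hGen_apply_apply]

theorem conj_mem_commutator {G : Type*} [Group G] {H : Subgroup G} {h g : G} (hh : h ∈ H)
    (hg : g ∈ ⁅H, H⁆) : h * g * h⁻¹ ∈ ⁅H, H⁆ := by
  have : ⁅h, g⁆ ∈ ⁅H, H⁆ :=
    Subgroup.commutator_mem_commutator hh (Subgroup.commutator_le_self H hg)
  simpa [commutatorElement_def] using mul_mem this hg

/-- `⁅H(3), H(3)⁆` contains a copy of itself acting below the vertex `0`. -/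
theorem psi_one_one_mem {k : Equiv.Perm (List (Fin 3))} (hk : k ∈ ⁅HanoiGroup 3, HanoiGroup 3⁆) :
    psi k 1 1 ∈ ⁅HanoiGroup 3, HanoiGroup 3⁆ := by
  have ha : hGen 0 1 ∈ HanoiGroup 3 := hGen_mem (by decide)
  have hb : hGen 0 2 ∈ HanoiGroup 3 := hGen_mem (by decide)
  have hc : hGen 1 2 ∈ HanoiGroup 3 := hGen_mem (by decide)
  let N : Subgroup (Equiv.Perm (List (Fin 3))) :=
    ⁅HanoiGroup 3, HanoiGroup 3⁆.comap (psiHom.comp (MonoidHom.inl _ _))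
  have hN (n) : n ∈ N ↔ psi n 1 1 ∈ ⁅HanoiGroup 3, HanoiGroup 3⁆ := Iff.rfl
  have hab : ⁅hGen (0 : Fin 3) 2, hGen (0 : Fin 3) 1⁆ ∈ N := by
    rw [hN, psi_commutator_zero_one]
    exact mul_mem (Subgroup.commutator_mem_commutator (mul_mem (mul_mem ha hb) hc) ha)
      (Subgroup.commutator_mem_commutator hc ha)
  have hac : ⁅hGen (0 : Fin 3) 1, hGen (1 : Fin 3) 2⁆ ∈ N := by
    rw [hN, psi_commutator_zero_one_one_two]
    exact Subgroup.commutator_mem_commutator (mul_mem (mul_mem hb ha) hb) hc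
  have hbc : ⁅hGen (0 : Fin 3) 2, hGen (1 : Fin 3) 2⁆ ∈ N := by
    rw [hN, psi_commutator_zero_two_one_two]
    exact Subgroup.commutator_mem_commutator (mul_mem (mul_mem ha hb) ha) hc
  have hconj_a : ∀ n ∈ N, hGen 0 1 * n * (hGen 0 1)⁻¹ ∈ N := by
    intro n hn
    have := conj_mem_commutator hb (conj_mem_commutator ha (conj_mem_commutator hb hn))
    simpa [hN, psiHom, hGen_zero_two_conj_psi, hGen_zero_one_conj_psi] using this
  have hconj_b : ∀ n ∈ N, hGen 0 2 * n * (hGen 0 2)⁻¹ ∈ N := by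
    intro n hn
    have := conj_mem_commutator ha (conj_mem_commutator hb (conj_mem_commutator ha hn))
    simpa [hN, psiHom, hGen_zero_two_conj_psi, hGen_zero_one_conj_psi] using this
  have hconj_c : ∀ n ∈ N, hGen 1 2 * n * (hGen 1 2)⁻¹ ∈ N := by
    intro n hn
    have := conj_mem_commutator hc hn
    simpa [hN, psiHom, hGen_one_two_conj_psi] using this
  have hconj : ∀ g ∈ HanoiGroup 3, ∀ n ∈ N, g * n * g⁻¹ ∈ N := by
    refine conj_mem_of_generators ?_
    rintro g (rfl | rfl | rfl)
    exacts [hconj_a, hconj_b, hconj_c]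
  refine (hN k).1 ((?_ : ⁅HanoiGroup 3, HanoiGroup 3⁆ ≤ N) hk)
  have swap : ∀ {x y}, ⁅x, y⁆ ∈ N → ⁅y, x⁆ ∈ N := fun {x y} h => by
    rw [← commutatorElement_inv]; exact N.inv_mem h
  rw [hanoiGroup_three_eq_closure] at hconj ⊢
  refine commutator_closure_le hconj ?_
  rintro x (rfl | rfl | rfl) y (rfl | rfl | rfl)
  exacts [by simp, swap hab, hac, hab, by simp, hbc, swap hac, swap hbc, by simp]

theorem psi_mem_commutator {p q r : Equiv.Perm (List (Fin 3))}
    (hp : p ∈ ⁅HanoiGroup 3, HanoiGroup 3⁆) (hq : q ∈ ⁅HanoiGroup 3, HanoiGroup 3⁆)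
    (hr : r ∈ ⁅HanoiGroup 3, HanoiGroup 3⁆) : psi p q r ∈ ⁅HanoiGroup 3, HanoiGroup 3⁆ := by
  have hq' := conj_mem_commutator (hGen_mem (by decide : (0 : Fin 3) < 1)) (psi_one_one_mem hq)
  have hr' := conj_mem_commutator (hGen_mem (by decide : (0 : Fin 3) < 2)) (psi_one_one_mem hr)
  rw [hGen_zero_one_conj_psi] at hq'
  rw [hGen_zero_two_conj_psi] at hr'
  simpa [psi_mul] using mul_mem (mul_mem (psi_one_one_mem hp) hq') hr'

instance finite_abelianization_hanoiGroup_three : Finite (Abelianization (HanoiGroup 3)) := by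
  have : Group.FG (HanoiGroup 3) := by
    rw [hanoiGroup_three_eq_closure]
    exact Group.closure_finite_fg _
  have : Group.FG (Abelianization (HanoiGroup 3)) :=
    Group.fg_of_surjective (f := Abelianization.of) (QuotientGroup.mk_surjective)
  have hsq (g) (hg : g ∈ HanoiGroup 3) : Abelianization.of (⟨g, hg⟩ : HanoiGroup 3) ^ 2 = 1 := by
    induction hg using Subgroup.closure_induction with
    | mem x hx =>
      obtain ⟨i, j, _, rfl⟩ := hx
      rw [← map_pow, pow_two]
      exact (congrArg Abelianization.of (Subtype.ext (hGen_mul_self i j))).trans (map_one _)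
    | one => exact (congrArg (· ^ 2) (map_one Abelianization.of)).trans (one_pow 2)
    | mul x y hx hy ihx ihy =>
      have : Abelianization.of (⟨x * y, mul_mem hx hy⟩ : HanoiGroup 3) =
          Abelianization.of ⟨x, hx⟩ * Abelianization.of ⟨y, hy⟩ :=
        map_mul Abelianization.of (⟨x, hx⟩ : HanoiGroup 3) ⟨y, hy⟩
      exact (congrArg (· ^ 2) this).trans (by rw [mul_pow, ihx, ihy, one_mul])
    | inv x hx ihx =>
      have : Abelianization.of (⟨x⁻¹, inv_mem hx⟩ : HanoiGroup 3) =
          (Abelianization.of ⟨x, hx⟩)⁻¹ :=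
        map_inv Abelianization.of (⟨x, hx⟩ : HanoiGroup 3)
      exact (congrArg (· ^ 2) this).trans (by rw [inv_pow, ihx, inv_one])
  refine CommGroup.finite_of_fg_isMulTorsion _ fun x => ?_
  obtain ⟨⟨g, hg⟩, rfl⟩ := QuotientGroup.mk_surjective x
  exact isOfFinOrder_iff_pow_eq_one.2 ⟨2, two_pos, hsq g hg⟩

theorem inv_mul_mem_commutator_of_abelianization_eq {G : Type*} [Group G] {H : Subgroup G}
    {s t : H} (h : Abelianization.of s = Abelianization.of t) : (s : G)⁻¹ * t ∈ ⁅H, H⁆ := by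
  have : s⁻¹ * t ∈ commutator H := QuotientGroup.eq.1 h
  rw [← Subgroup.map_subtype_commutator]
  exact ⟨_, this, rfl⟩

/-- Every element of `H(3)` permutes the first letters and acts below each of them by an element
of `H(3)`. -/
theorem exists_sections {h : Equiv.Perm (List (Fin 3))} (hh : h ∈ HanoiGroup 3) :
    h [] = [] ∧ ∃ (σ : Equiv.Perm (Fin 3)) (s : Fin 3 → HanoiGroup 3),
      ∀ x w, h (x :: w) = σ x :: (s x : Equiv.Perm (List (Fin 3))) w := by
  induction hh using Subgroup.closure_induction with
  | mem g hg =>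
    obtain ⟨i, j, hij, rfl⟩ := hg
    refine ⟨rfl, Equiv.swap i j, fun x => if x = i ∨ x = j then 1 else ⟨_, hGen_mem hij⟩, ?_⟩
    intro x w
    rw [hGen_apply_cons, Equiv.swap_apply_def]
    by_cases hi : x = i
    · simp [hi]
    · by_cases hj : x = j <;> simp [hi, hj, hij.ne']
  | one => exact ⟨rfl, 1, 1, fun _ _ => rfl⟩
  | mul g h _ _ ihg ihh =>
    obtain ⟨g0, σ, s, hs⟩ := ihg
    obtain ⟨h0, τ, t, ht⟩ := ihh
    exact ⟨by simp [g0, h0], σ * τ, fun x => s (τ x) * t x, fun x w => by simp [hs, ht]⟩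
  | inv g _ ih =>
    obtain ⟨g0, σ, s, hs⟩ := ih
    refine ⟨by rw [Equiv.Perm.inv_eq_iff_eq, g0], σ⁻¹, fun x => (s (σ⁻¹ x))⁻¹, fun x w => ?_⟩
    rw [Equiv.Perm.inv_eq_iff_eq, hs]
    simp

/-- `H(3)` is regularly branching over its commutator subgroup
`K = [H(3), H(3)]`: the image `ψ(K × K × K)` is a subgroup contained in `K`, normal in
`H(3)`, and of finite index in `H(3)`. -/
theorem hanoi3_regularly_branching :
    ∃ L : Subgroup (Equiv.Perm (List (Fin 3))),
      (L : Set (Equiv.Perm (List (Fin 3)))) =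
        {g | ∃ k₀ ∈ ⁅HanoiGroup 3, HanoiGroup 3⁆, ∃ k₁ ∈ ⁅HanoiGroup 3, HanoiGroup 3⁆,
          ∃ k₂ ∈ ⁅HanoiGroup 3, HanoiGroup 3⁆, g = psi k₀ k₁ k₂} ∧
      L ≤ ⁅HanoiGroup 3, HanoiGroup 3⁆ ∧
      (∀ h ∈ HanoiGroup 3, ∀ g ∈ L, h * g * h⁻¹ ∈ L) ∧
      (L.comap (HanoiGroup 3).subtype).FiniteIndex := by
  set K := ⁅HanoiGroup 3, HanoiGroup 3⁆
  let L := (K.prod (K.prod K)).map psiHom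
  have mem_L {g} : g ∈ L ↔ ∃ k₀ ∈ K, ∃ k₁ ∈ K, ∃ k₂ ∈ K, g = psi k₀ k₁ k₂ := by
    constructor
    · rintro ⟨⟨k₀, k₁, k₂⟩, ⟨h₀, h₁, h₂⟩, rfl⟩
      exact ⟨k₀, h₀, k₁, h₁, k₂, h₂, rfl⟩
    · rintro ⟨k₀, h₀, k₁, h₁, k₂, h₂, rfl⟩
      exact ⟨(k₀, k₁, k₂), ⟨h₀, h₁, h₂⟩, rfl⟩
  refine ⟨L, Set.ext fun g => mem_L, ?_, ?_, ?_⟩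
  · intro g hg
    obtain ⟨k₀, h₀, k₁, h₁, k₂, h₂, rfl⟩ := mem_L.1 hg
    exact psi_mem_commutator h₀ h₁ h₂
  · have ha : hGen 0 1 ∈ HanoiGroup 3 := hGen_mem (by decide)
    have hb : hGen 0 2 ∈ HanoiGroup 3 := hGen_mem (by decide)
    have hc : hGen 1 2 ∈ HanoiGroup 3 := hGen_mem (by decide)
    have hgen : ∀ h ∈ ({hGen 0 1, hGen 0 2, hGen 1 2} : Set (Equiv.Perm (List (Fin 3)))),
        ∀ g ∈ L, h * g * h⁻¹ ∈ L := by
      rintro h hh g hg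
      obtain ⟨k₀, h₀, k₁, h₁, k₂, h₂, rfl⟩ := mem_L.1 hg
      rcases hh with rfl | rfl | rfl
      · exact mem_L.2 ⟨_, h₁, _, h₀, _, conj_mem_commutator ha h₂, hGen_zero_one_conj_psi _ _ _⟩
      · exact mem_L.2 ⟨_, h₂, _, conj_mem_commutator hb h₁, _, h₀, hGen_zero_two_conj_psi _ _ _⟩
      · exact mem_L.2 ⟨_, conj_mem_commutator hc h₀, _, h₂, _, h₁, hGen_one_two_conj_psi _ _ _⟩
    exact conj_mem_of_generators hgen
  · choose h0 σ s hs using fun h : HanoiGroup 3 => exists_sections h.2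
    let F : HanoiGroup 3 → Equiv.Perm (Fin 3) × (Fin 3 → Abelianization (HanoiGroup 3)) :=
      fun h => (σ h, fun x => Abelianization.of (s h x))
    have hF (g h : HanoiGroup 3) (hgh : F g = F h) : g⁻¹ * h ∈ L.comap (HanoiGroup 3).subtype := by
      have hσ : σ g = σ h := congrArg Prod.fst hgh
      have hmem (x) : ((s g x)⁻¹ * s h x : Equiv.Perm (List (Fin 3))) ∈ K :=
        inv_mul_mem_commutator_of_abelianization_eq (congrFun (congrArg Prod.snd hgh) x)
      refine mem_L.2 ⟨_, hmem 0, _, hmem 1, _, hmem 2, ?_⟩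
      change (g : Equiv.Perm (List (Fin 3)))⁻¹ * h = _
      rw [inv_mul_eq_iff_eq_mul]
      ext1 l
      rcases l with _ | ⟨x, w⟩
      · simp [h0, psi_apply_nil]
      · fin_cases x <;> simp [hs, hσ, psi_apply_cons]
    have hinj : Function.Injective
        fun q : HanoiGroup 3 ⧸ L.comap (HanoiGroup 3).subtype => F q.out := by
      intro q r hqr
      rw [← q.out_eq', ← r.out_eq']
      exact QuotientGroup.eq.2 (hF _ _ hqr)
    have := Finite.of_injective _ hinj
    exact Subgroup.finiteIndex_of_finite_quotient
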